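/- Let K be the attractor of an IFS of similitudes on a complete metric space, endowed with its natural fractal structure. If the natural fractal structure is irreducible, then F satisfies the level separation property (LSP). -/

import Mathlib

open scoped ENNReal

namespace IFSMoran

variable {X : Type*} [MetricSpace X]

/-- The map `f_i = f_{i1} o ... o f_{in}` associated to a word `i = i1...in`
(a list of indices). -/
def wMap {k : ℕ} (f : Fin k → X → X) : List (Fin k) → X → X
  | [] => id
  | i :: w => f i ∘ wMap f w

/-- The piece `A_i = f_i(K)` of the natural fractal structure. -/
def piece {k : ℕ} (f : Fin k → X → X) (K : Set X) (w : List (Fin k)) : Set X :=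
  wMap f w '' K

/-- The natural fractal structure (levels indexed by words) is irreducible:
no level admits a proper subcovering. -/
def Irred {k : ℕ} (f : Fin k → X → X) (K : Set X) : Prop :=
  ∀ w : List (Fin k),
    ¬ piece f K w ⊆ ⋃ v ∈ {v : List (Fin k) | v.length = w.length ∧ v ≠ w}, piece f K v

/-- `H³ₙˢ(K) = inf_{l ≥ n} ∑_{i ∈ Σˡ} diam (A_i) ^ s`. -/
noncomputable def H3n {k : ℕ} (f : Fin k → X → X) (K : Set X) (s : ℝ) (n : ℕ) : ℝ≥0∞ :=
  ⨅ (l : ℕ) (_ : n ≤ l),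
    ∑ w : Fin l → Fin k, EMetric.diam (piece f K (List.ofFn w)) ^ s

/-- `H³ˢ(K) = lim_n H³ₙˢ(K)`; the sequence is nondecreasing in `n`, so the limit
is the supremum. -/
noncomputable def H3 {k : ℕ} (f : Fin k → X → X) (K : Set X) (s : ℝ) : ℝ≥0∞ :=
  ⨆ n, H3n f K s n

/-- Fractal dimension III: `dim³(K) = inf {s ≥ 0 : H³ˢ(K) = 0}`. -/
noncomputable def dim3 {k : ℕ} (f : Fin k → X → X) (K : Set X) : ℝ :=
  sInf {s : ℝ | 0 ≤ s ∧ H3 f K s = 0}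

/-- `H⁴ₙˢ(K)`: infimum of `∑ diam (A_i) ^ s` over finite coverings of `K` by
pieces indexed by words of length `≥ n`. -/
noncomputable def H4n {k : ℕ} (f : Fin k → X → X) (K : Set X) (s : ℝ) (n : ℕ) : ℝ≥0∞ :=
  ⨅ (𝒜 : Finset (List (Fin k))) (_ : ∀ w ∈ 𝒜, n ≤ w.length)
      (_ : K ⊆ ⋃ w ∈ 𝒜, piece f K w),
    ∑ w ∈ 𝒜, EMetric.diam (piece f K w) ^ s

/-- `H⁴ˢ(K) = lim_n H⁴ₙˢ(K)`; the sequence is nondecreasing in `n`, so the limit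
is the supremum. -/
noncomputable def H4 {k : ℕ} (f : Fin k → X → X) (K : Set X) (s : ℝ) : ℝ≥0∞ :=
  ⨆ n, H4n f K s n

/-- Fractal dimension IV: `dim⁴(K) = inf {s ≥ 0 : H⁴ˢ(K) = 0}`. -/
noncomputable def dim4 {k : ℕ} (f : Fin k → X → X) (K : Set X) : ℝ :=
  sInf {s : ℝ | 0 ≤ s ∧ H4 f K s = 0}

/-- Interior of `A` relative to `K` (as a subset of the ambient space `X`). -/
def intK (K A : Set X) : Set X := K \ closure (K \ A)

/-- The level separation property: interiors (in `K`) of two pieces indexed by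
distinct words of the same length are disjoint (LSP1), and every piece has
nonempty interior in `K` (LSP2). -/
def LSP {k : ℕ} (f : Fin k → X → X) (K : Set X) : Prop :=
  (∀ v w : List (Fin k), v.length = w.length → v ≠ w →
      intK K (piece f K v) ∩ intK K (piece f K w) = ∅) ∧
  ∀ w : List (Fin k), (intK K (piece f K w)).Nonempty

/-- The natural fractal structure is a tiling: pieces indexed by distinct words
of the same length have disjoint interiors in `K`, and every piece is regularly
closed in `K`, i.e. `cl_K (int_K (A_i)) = A_i`. -/
def IsTiling {k : ℕ} (f : Fin k → X → X) (K : Set X) : Prop :=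
  (∀ v w : List (Fin k), v.length = w.length → v ≠ w →
      intK K (piece f K v) ∩ intK K (piece f K w) = ∅) ∧
  ∀ w : List (Fin k), closure (intK K (piece f K w)) ∩ K = piece f K w


theorem wMap_append {k : ℕ} (f : Fin k → X → X) (v u : List (Fin k)) :
    wMap f (v ++ u) = wMap f v ∘ wMap f u := by
  induction v with
  | nil => rfl
  | cons i v ih => simp [wMap, ih, Function.comp_assoc]

theorem piece_append {k : ℕ} (f : Fin k → X → X) (K : Set X) (v u : List (Fin k)) :
    piece f K (v ++ u) = wMap f v '' piece f K u := by
  rw [piece, wMap_append, Set.image_comp, piece]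

theorem piece_cons {k : ℕ} (f : Fin k → X → X) (K : Set X) (i : Fin k) (w : List (Fin k)) :
    piece f K (i :: w) = f i '' piece f K w :=
  Set.image_comp _ _ _

theorem piece_subset {k : ℕ} {f : Fin k → X → X} {K : Set X} (hK : K = ⋃ i, f i '' K)
    (w : List (Fin k)) : piece f K w ⊆ K := by
  induction w with
  | nil => simp [piece, wMap]
  | cons i w ih =>
    rw [piece_cons]
    conv_rhs => rw [hK]
    exact (Set.image_mono ih).trans (Set.subset_iUnion (fun i => f i '' K) i)

theorem exists_mem_piece_of_length {k : ℕ} {f : Fin k → X → X} {K : Set X}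
    (hK : K = ⋃ i, f i '' K) (n : ℕ) {x : X} (hx : x ∈ K) :
    ∃ u : List (Fin k), u.length = n ∧ x ∈ piece f K u := by
  induction n generalizing x with
  | zero => exact ⟨[], rfl, by simpa [piece, wMap] using hx⟩
  | succ n ih =>
    rw [hK] at hx
    obtain ⟨i, y, hy, rfl⟩ := Set.mem_iUnion.1 hx
    obtain ⟨u, hu, hyu⟩ := ih hy
    exact ⟨i :: u, by simp [hu], by rw [piece_cons]; exact Set.mem_image_of_mem _ hyu⟩

theorem exists_mem_piece_append {k : ℕ} {f : Fin k → X → X} {K : Set X}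
    (hK : K = ⋃ i, f i '' K) (n : ℕ) {v : List (Fin k)} {x : X} (hx : x ∈ piece f K v) :
    ∃ u : List (Fin k), u.length = n ∧ x ∈ piece f K (v ++ u) := by
  obtain ⟨y, hy, rfl⟩ := hx
  obtain ⟨u, hu, hyu⟩ := exists_mem_piece_of_length hK n hy
  exact ⟨u, hu, by rw [piece_append]; exact Set.mem_image_of_mem _ hyu⟩

theorem dist_wMap_le {k : ℕ} {f : Fin k → X → X} {C : ℝ} (hC : 0 ≤ C)
    (hf : ∀ i x y, dist (f i x) (f i y) ≤ C * dist x y) (w : List (Fin k)) (x y : X) :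
    dist (wMap f w x) (wMap f w y) ≤ C ^ w.length * dist x y := by
  induction w with
  | nil => simp [wMap]
  | cons i w ih =>
    calc dist (f i (wMap f w x)) (f i (wMap f w y))
        ≤ C * dist (wMap f w x) (wMap f w y) := hf _ _ _
      _ ≤ C * (C ^ w.length * dist x y) := by gcongr
      _ = C ^ (i :: w).length * dist x y := by rw [List.length_cons, pow_succ]; ring

theorem continuous_wMap {k : ℕ} {f : Fin k → X → X} (hf : ∀ i, Continuous (f i))
    (w : List (Fin k)) : Continuous (wMap f w) := by
  induction w with
  | nil => exact continuous_id
  | cons i w ih => exact (hf i).comp ih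

theorem exists_contraction_bound {ι : Type*} [Finite ι] {c : ι → ℝ}
    (hc : ∀ i, c i < 1) : ∃ C : ℝ, 0 ≤ C ∧ C < 1 ∧ ∀ i, c i ≤ C := by
  rcases isEmpty_or_nonempty ι with h | h
  · exact ⟨0, le_rfl, one_pos, fun i => h.elim i⟩
  · obtain ⟨j, hj⟩ := Finite.exists_max c
    exact ⟨max 0 (c j), le_max_left _ _, max_lt one_pos (hc j),
      fun i => (hj i).trans (le_max_right _ _)⟩

theorem intK_subset (K A : Set X) : intK K A ⊆ A := fun x hx => by
  by_contra hxA
  exact hx.2 (subset_closure ⟨hx.1, hxA⟩)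

/-- If no level has a proper subcovering, every piece has nonempty relative interior. -/
theorem Irred.intK_nonempty {k : ℕ} {f : Fin k → X → X} {K : Set X} (hirr : Irred f K)
    (hf : ∀ i, Continuous (f i)) (hKcp : IsCompact K) (hK : K = ⋃ i, f i '' K)
    (w : List (Fin k)) : (intK K (piece f K w)).Nonempty := by
  obtain ⟨x, hxw, hx⟩ := Set.not_subset.1 (hirr w)
  have hclosed : IsClosed (⋃ v ∈ {v : List (Fin k) | v.length = w.length ∧ v ≠ w},
      piece f K v) :=
    ((List.finite_length_eq (Fin k) w.length).subset fun _ hv => hv.1).isClosed_biUnion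
      fun v _ => (hKcp.image (continuous_wMap hf v)).isClosed
  refine ⟨x, piece_subset hK w hxw, fun hcl => hx (closure_minimal ?_ hclosed hcl)⟩
  rintro y ⟨hyK, hyw⟩
  obtain ⟨u, hu, hyu⟩ := exists_mem_piece_of_length hK w.length hyK
  exact Set.mem_biUnion (show u ∈ {v | _} from ⟨hu, by rintro rfl; exact hyw hyu⟩) hyu

/-- In an irreducible structure, a piece does not meet the relative interior of another piece
of the same level. -/
theorem Irred.piece_inter_intK_eq_empty {k : ℕ} {f : Fin k → X → X} {K : Set X}
    (hirr : Irred f K) {C : ℝ} (hC0 : 0 ≤ C) (hC1 : C < 1)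
    (hf : ∀ i x y, dist (f i x) (f i y) ≤ C * dist x y)
    (hKb : Bornology.IsBounded K) (hK : K = ⋃ i, f i '' K)
    {v w : List (Fin k)} (hlen : v.length = w.length) (hne : v ≠ w) :
    piece f K v ∩ intK K (piece f K w) = ∅ := by
  refine Set.eq_empty_of_forall_notMem ?_
  rintro x ⟨hxv, -, hxw⟩
  obtain ⟨ε, hε, hball⟩ : ∃ ε > 0, ∀ y ∈ K \ piece f K w, ε ≤ dist x y := by
    simpa [Metric.mem_closure_iff] using hxw
  have hlim : Filter.Tendsto (fun n : ℕ => C ^ n * Metric.diam K) Filter.atTop (nhds 0) := by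
    simpa using (tendsto_pow_atTop_nhds_zero_of_lt_one hC0 hC1).mul_const (Metric.diam K)
  obtain ⟨n, hn⟩ := (hlim.eventually_lt_const hε).exists
  obtain ⟨u, hu, hxu⟩ := exists_mem_piece_append hK n hxv
  refine hirr (v ++ u) fun y hyu => ?_
  have hdist : dist x y < ε := by
    obtain ⟨a, ha, rfl⟩ := hxu
    obtain ⟨b, hb, rfl⟩ := hyu
    calc dist (wMap f (v ++ u) a) (wMap f (v ++ u) b)
        ≤ C ^ (v ++ u).length * dist a b := dist_wMap_le hC0 hf _ _ _
      _ ≤ C ^ n * Metric.diam K := by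
        gcongr ?_ * ?_
        · exact pow_le_pow_of_le_one hC0 hC1.le (by simp [hu])
        · exact Metric.dist_le_diam_of_mem hKb ha hb
      _ < ε := hn
  have hyw : y ∈ piece f K w := by
    by_contra hyw
    exact (hball y ⟨piece_subset hK _ hyu, hyw⟩).not_gt hdist
  obtain ⟨u', hu', hyu'⟩ := exists_mem_piece_append hK n hyw
  refine Set.mem_biUnion (show w ++ u' ∈ {z | _} from ⟨by simp [hu, hu', hlen], fun h => ?_⟩) hyu'
  exact hne (List.append_inj_left h hlen.symm).symm

theorem stmt_8 {X : Type*} [MetricSpace X] [CompleteSpace X]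
    {k : ℕ} (hk : 2 ≤ k) (f : Fin k → X → X) (c : Fin k → ℝ)
    (hc : ∀ i, c i ∈ Set.Ioo (0 : ℝ) 1)
    (hf : ∀ i x y, dist (f i x) (f i y) = c i * dist x y)
    (K : Set X) (hKne : K.Nonempty) (hKcp : IsCompact K)
    (hK : K = ⋃ i, f i '' K)
    (hirr : Irred f K) :
    LSP f K := by
  obtain ⟨C, hC0, hC1, hcC⟩ := exists_contraction_bound fun i => (hc i).2
  have hfC : ∀ i x y, dist (f i x) (f i y) ≤ C * dist x y := fun i x y =>
    (hf i x y).trans_le (mul_le_mul_of_nonneg_right (hcC i) dist_nonneg)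
  have hcont : ∀ i, Continuous (f i) := fun i =>
    (LipschitzWith.of_dist_le_mul (K := ⟨C, hC0⟩) (hfC i)).continuous
  refine ⟨fun v w hlen hne => Set.subset_empty_iff.1 ?_,
    hirr.intK_nonempty hcont hKcp hK⟩
  rw [← hirr.piece_inter_intK_eq_empty hC0 hC1 hfC hKcp.isBounded hK hlen hne]
  exact Set.inter_subset_inter_left _ (intK_subset _ _)

end IFSMoran
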